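/- Let m ≤ n be positive integers and let Ω = {λ ∈ ℝ^m : λ₁ > λ₂ > ⋯ > λ_m > 0}. Let p(λ) = c_{m,n} · e^{−(λ₁+⋯+λ_m)} · ∏_{i=1}^m λ_i^{n−m} · ∏_{1≤i<j≤m} (λ_i − λ_j)², where c_{m,n} > 0 is the normalizing constant making ∫_Ω p(λ) dλ = 1. For 1 ≤ i ≤ m define F_{λ_i}(t) = ∫_{Ω ∩ {λ : λ_i < t}} p(λ) dλ (the CDF of the i-th largest coordinate). Then there exists a constant β_i > 0 such that lim_{t→0⁺} F_{λ_i}(t)/t^{(n−i+1)(m−i+1)} = β_i; that is, F_{λ_i}(t) = β_i · t^{(n−i+1)(m−i+1)} + o(t^{(n−i+1)(m−i+1)}) as t → 0⁺. -/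

import Mathlib

open Filter Set MeasureTheory

/-- The factor by which coordinate `a` is rescaled: coordinates from `i` on are scaled by `t`. -/
def blockScale {m : ℕ} (i : Fin m) (t : ℝ) (a : Fin m) : ℝ := if a < i then 1 else t

/-- The ratio `blockScale i t b / blockScale i t a` for `a < b`. -/
def crossScale {m : ℕ} (i : Fin m) (t : ℝ) (a b : Fin m) : ℝ := if a < i ∧ i ≤ b then t else 1

/-- The Wishart eigenvalue density after rescaling, with its homogeneous power of `t` removed. -/
noncomputable def rescaledDensity {m : ℕ} (c : ℝ) (D : ℕ) (i : Fin m) (t : ℝ)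
    (y : Fin m → ℝ) : ℝ :=
  c * Real.exp (-(∑ a, blockScale i t a * y a)) * (∏ a, y a ^ D) *
    ∏ a, ∏ b, (if a < b then (y a - crossScale i t a b * y b) ^ 2 else 1)

/-- The preimage of `{λ₁ > ⋯ > λ_m > 0, λ_i < t}` under the rescaling. -/
def rescaledRegion {m : ℕ} (i : Fin m) (t : ℝ) : Set (Fin m → ℝ) :=
  {y | (∀ a, 0 < y a) ∧ (∀ a b, a < b → crossScale i t a b * y b < y a) ∧ y i < 1}

/-- The exponent of the coordinate `a` in the monomial dominating the density. -/
def dominatingExponent {m : ℕ} (D : ℕ) (a : Fin m) : ℕ := D + ∑ b, if a < b then 2 else 0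

theorem blockScale_mul_crossScale {m : ℕ} (i : Fin m) (t : ℝ) {a b : Fin m} (hab : a < b) :
    blockScale i t a * crossScale i t a b = blockScale i t b := by
  unfold blockScale crossScale
  by_cases ha : a < i <;> by_cases hb : b < i
  · simp [ha, hb]
  · simp [ha, hb, not_lt.mp hb]
  · exact absurd (hab.trans hb) ha
  · simp [ha, hb]

theorem isOpen_rescaledRegion {m : ℕ} (i : Fin m) (t : ℝ) : IsOpen (rescaledRegion i t) := by
  simp only [rescaledRegion, ofPred_and, ofPred_forall]
  refine IsOpen.inter (isOpen_iInter_of_finite fun a => ?_) (IsOpen.inter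
    (isOpen_iInter_of_finite fun a => isOpen_iInter_of_finite fun b =>
      isOpen_iInter_of_finite fun _ => ?_) ?_)
  all_goals exact isOpen_lt (by fun_prop) (by fun_prop)

theorem rescaledRegion_zero_nonempty {m : ℕ} (i : Fin m) : (rescaledRegion i 0).Nonempty := by
  refine ⟨fun a => 1 / ((a : ℝ) + 2), fun a => by positivity, fun a b hab => ?_, ?_⟩
  · have hab' : (a : ℝ) < b := by exact_mod_cast hab
    have hlt : 1 / ((b : ℝ) + 2) < 1 / ((a : ℝ) + 2) :=
      one_div_lt_one_div_of_lt (by positivity) (by linarith)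
    unfold crossScale
    split_ifs
    · rw [zero_mul]; positivity
    · rwa [one_mul]
  · rw [div_lt_one (by positivity)]
    have : (0 : ℝ) ≤ i := by positivity
    linarith

theorem rescaledRegion_subset_zero {m : ℕ} (i : Fin m) {t : ℝ} (ht : 0 ≤ t) :
    rescaledRegion i t ⊆ rescaledRegion i 0 := by
  rintro y ⟨hpos, hlt, hi⟩
  refine ⟨hpos, fun a b hab => lt_of_le_of_lt ?_ (hlt a b hab), hi⟩
  refine mul_le_mul_of_nonneg_right ?_ (hpos b).le
  unfold crossScale
  split_ifs <;> simp [ht]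

theorem continuous_rescaledDensity {m : ℕ} (c : ℝ) (D : ℕ) (i : Fin m) (t : ℝ) :
    Continuous (rescaledDensity c D i t) := by
  unfold rescaledDensity
  refine Continuous.mul (by fun_prop) (continuous_finsetProd _ fun a _ =>
    continuous_finsetProd _ fun b _ => ?_)
  split_ifs <;> fun_prop

theorem continuous_crossScale {m : ℕ} (i a b : Fin m) :
    Continuous fun t => crossScale i t a b := by
  unfold crossScale
  split_ifs <;> fun_prop

theorem continuous_blockScale {m : ℕ} (i a : Fin m) : Continuous fun t => blockScale i t a := by
  unfold blockScale
  split_ifs <;> fun_prop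

theorem continuous_rescaledDensity_param {m : ℕ} (c : ℝ) (D : ℕ) (i : Fin m)
    (y : Fin m → ℝ) : Continuous fun t => rescaledDensity c D i t y := by
  have hcross := continuous_crossScale (m := m)
  have hblock := continuous_blockScale (m := m)
  unfold rescaledDensity
  refine Continuous.mul ?_ (continuous_finsetProd _ fun a _ =>
    continuous_finsetProd _ fun b _ => ?_)
  · have : Continuous fun t => ∑ a, blockScale i t a * y a :=
      continuous_finsetSum _ fun a _ => (hblock i a).mul continuous_const
    fun_prop
  · split_ifs
    · exact (continuous_const.sub ((hcross i a b).mul continuous_const)).pow 2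
    · exact continuous_const

theorem rescaledDensity_pos {m : ℕ} {c : ℝ} (hc : 0 < c) (D : ℕ) (i : Fin m) {t : ℝ}
    {y : Fin m → ℝ} (hy : y ∈ rescaledRegion i t) : 0 < rescaledDensity c D i t y := by
  obtain ⟨hpos, hlt, -⟩ := hy
  unfold rescaledDensity
  refine mul_pos (mul_pos (by positivity) (Finset.prod_pos fun a _ => pow_pos (hpos a) _))
    (Finset.prod_pos fun a _ => Finset.prod_pos fun b _ => ?_)
  split_ifs with hab
  · exact pow_pos (sub_pos.mpr (hlt a b hab)) 2
  · exact one_pos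

theorem prod_pow_mul_prod_sq {m : ℕ} (D : ℕ) (y : Fin m → ℝ) :
    (∏ a, y a ^ D) * ∏ a, ∏ b, (if a < b then y a ^ 2 else 1) =
      ∏ a, y a ^ dominatingExponent D a := by
  rw [← Finset.prod_mul_distrib]
  refine Finset.prod_congr rfl fun a _ => ?_
  rw [dominatingExponent, pow_add, ← Finset.prod_pow_eq_pow_sum]
  congr 1
  refine Finset.prod_congr rfl fun b _ => ?_
  split_ifs <;> simp

theorem rescaledDensity_le {m : ℕ} {c : ℝ} (hc : 0 < c) (D : ℕ) (i : Fin m) {t : ℝ}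
    (ht : 0 ≤ t) {y : Fin m → ℝ} (hy : y ∈ rescaledRegion i t) :
    rescaledDensity c D i t y ≤
      c * ∏ a, (Real.exp 1 * (Real.exp (-y a) * y a ^ dominatingExponent D a)) := by
  obtain ⟨hpos, hlt, hi⟩ := hy
  have hcross : ∀ a b, 0 ≤ crossScale i t a b := fun a b => by
    unfold crossScale; split_ifs <;> simp [ht]
  have hexp : Real.exp (-(∑ a, blockScale i t a * y a)) ≤
      ∏ a, (Real.exp 1 * Real.exp (-y a)) := by
    rw [← Finset.sum_neg_distrib, Real.exp_sum]
    refine Finset.prod_le_prod (fun a _ => (Real.exp_pos _).le) fun a _ => ?_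
    rw [← Real.exp_add, Real.exp_le_exp]
    unfold blockScale
    split_ifs with ha
    · linarith
    · have hya : y a ≤ y i := by
        rcases (not_lt.mp ha).eq_or_lt with h | h
        · rw [h]
        · have := hlt i a h
          simp only [crossScale, lt_irrefl, false_and, if_false, one_mul] at this
          exact this.le
      have := mul_nonneg ht (hpos a).le
      linarith
  have hvdm : (∏ a, ∏ b, (if a < b then (y a - crossScale i t a b * y b) ^ 2 else 1)) ≤
      ∏ a, ∏ b, (if a < b then y a ^ 2 else 1) := by
    refine Finset.prod_le_prod (fun a _ => Finset.prod_nonneg fun b _ => ?_) fun a _ =>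
      Finset.prod_le_prod (fun b _ => ?_) fun b _ => ?_
    · split_ifs <;> positivity
    · split_ifs <;> positivity
    · split_ifs with hab
      · have h1 := hlt a b hab
        have h2 := mul_nonneg (hcross a b) (hpos b).le
        exact pow_le_pow_left₀ (by linarith) (by linarith) 2
      · exact le_rfl
  have hprod : 0 ≤ ∏ a, y a ^ D := Finset.prod_nonneg fun a _ => pow_nonneg (hpos a).le _
  calc rescaledDensity c D i t y
      = c * (Real.exp (-(∑ a, blockScale i t a * y a)) * ((∏ a, y a ^ D) *
          ∏ a, ∏ b, (if a < b then (y a - crossScale i t a b * y b) ^ 2 else 1))) := by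
        unfold rescaledDensity; ring
    _ ≤ c * ((∏ a, (Real.exp 1 * Real.exp (-y a))) * ((∏ a, y a ^ D) *
          ∏ a, ∏ b, (if a < b then y a ^ 2 else 1))) := by
        refine mul_le_mul_of_nonneg_left (mul_le_mul hexp
          (mul_le_mul_of_nonneg_left hvdm hprod) (mul_nonneg hprod ?_) ?_) hc.le
        · exact Finset.prod_nonneg fun a _ => Finset.prod_nonneg fun b _ => by
            split_ifs <;> positivity
        · exact Finset.prod_nonneg fun a _ => by positivity
    _ = _ := by
        rw [prod_pow_mul_prod_sq, ← Finset.prod_mul_distrib]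
        simp only [mul_assoc]

theorem integrable_prod_exp_neg_mul_pow {ι : Type*} [Fintype ι] (K : ℝ) (e : ι → ℕ) :
    Integrable fun y : ι → ℝ =>
      ∏ a, (Ioi (0 : ℝ)).indicator (fun x => K * (Real.exp (-x) * x ^ e a)) (y a) := by
  refine Integrable.fintype_prod
    (f := fun a => (Ioi (0 : ℝ)).indicator fun x => K * (Real.exp (-x) * x ^ e a)) fun a => ?_
  rw [integrable_indicator_iff measurableSet_Ioi]
  refine Integrable.const_mul ?_ K
  have h := Real.GammaIntegral_convergent (s := (e a : ℝ) + 1) (by positivity)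
  simpa only [add_sub_cancel_right, Real.rpow_natCast, IntegrableOn] using h

/-- Dominated convergence for the rescaled integrals. -/
theorem tendsto_setIntegral_rescaledDensity {m : ℕ} {c : ℝ} (hc : 0 < c) (D : ℕ) (i : Fin m) :
    IntegrableOn (rescaledDensity c D i 0) (rescaledRegion i 0) ∧
    Tendsto (fun t => ∫ y in rescaledRegion i t, rescaledDensity c D i t y)
      (nhdsWithin 0 (Ioi 0))
      (nhds (∫ y in rescaledRegion i 0, rescaledDensity c D i 0 y)) := by
  have hmeas := fun t => (isOpen_rescaledRegion i t).measurableSet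
  set g : (Fin m → ℝ) → ℝ := fun y => c * ∏ a, (Ioi (0 : ℝ)).indicator
    (fun x => Real.exp 1 * (Real.exp (-x) * x ^ dominatingExponent D a)) (y a) with hg
  have hgi : Integrable g := (integrable_prod_exp_neg_mul_pow _ _).const_mul c
  have hg0 : ∀ y, 0 ≤ g y := fun y => mul_nonneg hc.le <| Finset.prod_nonneg fun a _ =>
    indicator_nonneg (fun x (hx : 0 < x) => by positivity) _
  have hbound : ∀ t, 0 ≤ t → ∀ y,
      ‖(rescaledRegion i t).indicator (rescaledDensity c D i t) y‖ ≤ g y := by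
    intro t ht y
    by_cases hy : y ∈ rescaledRegion i t
    · rw [indicator_of_mem hy, Real.norm_of_nonneg (rescaledDensity_pos hc D i hy).le]
      refine (rescaledDensity_le hc D i ht hy).trans_eq ?_
      rw [hg]
      congr 1
      refine Finset.prod_congr rfl fun a _ => ?_
      rw [indicator_of_mem (mem_Ioi.mpr (hy.1 a))]
    · rw [indicator_of_notMem hy, norm_zero]
      exact hg0 y
  have hsm : ∀ t, AEStronglyMeasurable
      ((rescaledRegion i t).indicator (rescaledDensity c D i t)) volume := fun t =>
    (continuous_rescaledDensity c D i t).aestronglyMeasurable.indicator (hmeas t)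
  constructor
  · rw [← integrable_indicator_iff (hmeas 0)]
    exact hgi.mono' (hsm 0) (ae_of_all _ (hbound 0 le_rfl))
  · simp_rw [← integral_indicator (hmeas _)]
    refine tendsto_integral_filter_of_dominated_convergence g (Eventually.of_forall hsm) ?_ hgi
      (ae_of_all _ fun y => ?_)
    · filter_upwards [self_mem_nhdsWithin] with t ht
      exact ae_of_all _ (hbound t (le_of_lt ht))
    · by_cases hy : y ∈ rescaledRegion i 0
      · rw [indicator_of_mem hy]
        have hev : ∀ᶠ t in nhdsWithin (0 : ℝ) (Ioi 0), y ∈ rescaledRegion i t := by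
          refine eventually_nhdsWithin_of_eventually_nhds ?_
          refine eventually_and.mpr ⟨Eventually.of_forall fun _ => hy.1,
            eventually_and.mpr ⟨?_, Eventually.of_forall fun _ => hy.2.2⟩⟩
          refine eventually_all.mpr fun a => eventually_all.mpr fun b =>
            eventually_all.mpr fun hab => ?_
          exact ((continuous_crossScale i a b).mul continuous_const).continuousAt.eventually_lt
            continuousAt_const (hy.2.1 a b hab)
        refine Tendsto.congr' (hev.mono fun t ht => (indicator_of_mem ht _).symm) ?_
        exact ((continuous_rescaledDensity_param c D i y).tendsto 0).mono_left nhdsWithin_le_nhds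
      · rw [indicator_of_notMem hy]
        refine tendsto_const_nhds.congr' ?_
        filter_upwards [self_mem_nhdsWithin] with t ht
        exact (indicator_of_notMem
          (fun h => hy (rescaledRegion_subset_zero i (le_of_lt ht) h)) _).symm

theorem setIntegral_rescaledDensity_zero_pos {m : ℕ} {c : ℝ} (hc : 0 < c) (D : ℕ) (i : Fin m) :
    0 < ∫ y in rescaledRegion i 0, rescaledDensity c D i 0 y := by
  have hopen := isOpen_rescaledRegion i 0
  rw [setIntegral_pos_iff_support_of_nonneg_ae
    ((ae_restrict_iff' hopen.measurableSet).mpr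
      (ae_of_all _ fun y hy => (rescaledDensity_pos hc D i hy).le))
    (tendsto_setIntegral_rescaledDensity hc D i).1]
  have hsub : rescaledRegion i 0 ⊆ Function.support (rescaledDensity c D i 0) :=
    fun y hy => (rescaledDensity_pos hc D i hy).ne'
  rw [inter_eq_right.mpr hsub]
  exact hopen.measure_pos volume (rescaledRegion_zero_nonempty i)

theorem setIntegral_eq_prod_mul_setIntegral_comp_mul {ι : Type*} [Fintype ι]
    {d : ι → ℝ} (hd : ∀ a, 0 < d a) {s : Set (ι → ℝ)} (hs : MeasurableSet s)
    {f : (ι → ℝ) → ℝ} (hf : Measurable f) :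
    ∫ x in s, f x = (∏ a, d a) * ∫ y in {y : ι → ℝ | (fun a => d a * y a) ∈ s}, f fun a => d a * y a := by
  classical
  have hpos : 0 < ∏ a, d a := Finset.prod_pos fun a _ => hd a
  have hvol := Real.smul_map_diagonal_volume_pi (D := d)
    (by rw [Matrix.det_diagonal]; exact hpos.ne')
  have hmap : (Matrix.toLin' (Matrix.diagonal d) : (ι → ℝ) → ι → ℝ) =
      fun y a => d a * y a := by
    ext y a
    simp [Matrix.toLin'_apply, Matrix.mulVec_diagonal]
  rw [Matrix.det_diagonal, abs_of_pos hpos, hmap] at hvol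
  have hm : Measurable fun (y : ι → ℝ) a => d a * y a := by fun_prop
  conv_lhs => rw [← hvol]
  rw [Measure.restrict_smul, integral_smul_measure, ENNReal.toReal_ofReal hpos.le, smul_eq_mul,
    setIntegral_map hs hf.aestronglyMeasurable hm.aemeasurable]
  rfl

theorem sum_range_one_add_two_mul (D k : ℕ) :
    ∑ j ∈ Finset.range k, (1 + (D + 2 * j)) = (D + k) * k := by
  induction k with
  | zero => simp
  | succ k ih => rw [Finset.sum_range_succ, ih]; ring

theorem prod_blockScale_pow {m : ℕ} (D : ℕ) (i : Fin m) (t : ℝ) :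
    (∏ a, blockScale i t a) * ∏ a, blockScale i t a ^ dominatingExponent D a =
      t ^ ((D + (m - i)) * (m - i)) := by
  have hsum : ∑ a : Fin m, (if (a : ℕ) < i then 0 else 1 + (D + 2 * (m - 1 - a))) =
      (D + (m - i)) * (m - i) := by
    rw [Fin.sum_univ_eq_sum_range
      (fun a => if a < (i : ℕ) then 0 else 1 + (D + 2 * (m - 1 - a))) m,
      ← Finset.sum_range_add_sum_Ico _ i.isLt.le,
      Finset.sum_eq_zero fun a ha => if_pos (Finset.mem_range.mp ha), zero_add,
      Finset.sum_Ico_eq_sum_range, ← sum_range_one_add_two_mul, ← Finset.sum_range_reflect]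
    refine Finset.sum_congr rfl fun j hj => ?_
    rw [Finset.mem_range] at hj
    rw [if_neg (by omega)]
    omega
  rw [← Finset.prod_mul_distrib, ← hsum, ← Finset.prod_pow_eq_pow_sum]
  refine Finset.prod_congr rfl fun a _ => ?_
  have hexp : dominatingExponent D a = D + 2 * (m - 1 - a) := by
    rw [dominatingExponent, ← Finset.sum_filter, Finset.sum_const, Finset.filter_lt_eq_Ioi,
      Fin.card_Ioi, smul_eq_mul, mul_comm]
  rw [← pow_succ', hexp, add_comm _ 1, blockScale]
  simp only [Fin.lt_def]
  split_ifs <;> simp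

theorem density_comp_blockScale {m : ℕ} (c : ℝ) (D : ℕ) (i : Fin m) (t : ℝ) (y : Fin m → ℝ) :
    c * Real.exp (-(∑ a, blockScale i t a * y a)) * (∏ a, (blockScale i t a * y a) ^ D) *
        ∏ a, ∏ b, (if a < b then (blockScale i t a * y a - blockScale i t b * y b) ^ 2 else 1) =
      (∏ a, blockScale i t a ^ dominatingExponent D a) * rescaledDensity c D i t y := by
  have hvdm : (∏ a, ∏ b,
      (if a < b then (blockScale i t a * y a - blockScale i t b * y b) ^ 2 else 1)) =
      (∏ a, ∏ b : Fin m, (if a < b then blockScale i t a ^ 2 else 1)) *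
        ∏ a, ∏ b, (if a < b then (y a - crossScale i t a b * y b) ^ 2 else 1) := by
    simp_rw [← Finset.prod_mul_distrib]
    refine Finset.prod_congr rfl fun a _ => Finset.prod_congr rfl fun b _ => ?_
    split_ifs with hab
    · rw [← blockScale_mul_crossScale i t hab]; ring
    · rw [one_mul]
  simp_rw [hvdm, mul_pow, Finset.prod_mul_distrib]
  rw [← prod_pow_mul_prod_sq, rescaledDensity]
  ring

theorem blockScale_mul_mem_iff {m : ℕ} (i : Fin m) {t : ℝ} (ht : 0 < t) (y : Fin m → ℝ) :
    (fun a => blockScale i t a * y a) ∈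
        {lam : Fin m → ℝ | StrictAnti lam ∧ ∀ a, 0 < lam a} ∩ {lam | lam i < t} ↔
      y ∈ rescaledRegion i t := by
  have hd : ∀ a, 0 < blockScale i t a := fun a => by
    unfold blockScale; split_ifs <;> simp [ht]
  have hlt : ∀ a b, a < b → (blockScale i t b * y b < blockScale i t a * y a ↔
      crossScale i t a b * y b < y a) := fun a b hab => by
    rw [← blockScale_mul_crossScale i t hab, mul_assoc, mul_lt_mul_iff_right₀ (hd a)]
  have hi : blockScale i t i * y i < t ↔ y i < 1 := by
    rw [blockScale, if_neg (lt_irrefl i), mul_lt_iff_lt_one_right ht]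
  simp only [rescaledRegion, mem_inter_iff, mem_ofPred_eq, hi, mul_pos_iff_of_pos_left (hd _)]
  constructor
  · rintro ⟨⟨hanti, hpos⟩, hone⟩
    exact ⟨hpos, fun a b hab => (hlt a b hab).mp (hanti hab), hone⟩
  · rintro ⟨hpos, hanti, hone⟩
    exact ⟨⟨fun a b hab => (hlt a b hab).mpr (hanti a b hab), hpos⟩, hone⟩

theorem measurableSet_strictAnti_pos_inter {m : ℕ} (i : Fin m) (t : ℝ) :
    MeasurableSet
      ({lam : Fin m → ℝ | StrictAnti lam ∧ ∀ a, 0 < lam a} ∩ {lam | lam i < t}) := by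
  simp only [StrictAnti, ofPred_and, ofPred_forall]
  refine MeasurableSet.inter (MeasurableSet.inter (MeasurableSet.iInter fun a =>
    MeasurableSet.iInter fun b => MeasurableSet.iInter fun _ => ?_)
    (MeasurableSet.iInter fun a => ?_)) ?_
  all_goals exact measurableSet_lt (by fun_prop) (by fun_prop)

/-- Paper's Lemma 1: asymptotic behaviour of the CDF of the `i`-th largest ordered
eigenvalue of a complex Wishart matrix. Here `lam : Fin m → ℝ` lists the eigenvalues
in strictly decreasing order (`lam 0` is the largest), so the index `i : Fin m`
corresponds to the `(i+1)`-th largest eigenvalue, with exponent `(n - i) * (m - i)`. -/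
theorem wishart_ordered_eigenvalue_cdf_asymptotic
    (m n : ℕ) (hm : 0 < m) (hmn : m ≤ n)
    (c : ℝ) (hc : 0 < c)
    (p : (Fin m → ℝ) → ℝ)
    (hp : ∀ lam : Fin m → ℝ,
      p lam = c * Real.exp (-(∑ i, lam i)) * (∏ i, lam i ^ (n - m)) *
        ∏ i, ∏ j, (if i < j then (lam i - lam j) ^ 2 else 1))
    (Ω : Set (Fin m → ℝ))
    (hΩ : Ω = {lam | StrictAnti lam ∧ ∀ i, 0 < lam i})
    (hnorm : ∫ lam in Ω, p lam = 1) :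
    ∀ i : Fin m, ∃ β : ℝ, 0 < β ∧
      Tendsto
        (fun t : ℝ =>
          (∫ lam in Ω ∩ {lam | lam i < t}, p lam) / t ^ ((n - (i : ℕ)) * (m - (i : ℕ))))
        (nhdsWithin 0 (Set.Ioi 0)) (nhds β) := by
  intro i
  refine ⟨_, setIntegral_rescaledDensity_zero_pos hc (n - m) i,
    (tendsto_setIntegral_rescaledDensity hc (n - m) i).2.congr' ?_⟩
  filter_upwards [self_mem_nhdsWithin] with t ht
  have ht : 0 < t := ht
  have hp_meas : Measurable p := by
    rw [funext hp]
    refine Measurable.mul (by fun_prop) (Finset.measurable_prod _ fun a _ =>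
      Finset.measurable_prod _ fun b _ => ?_)
    split_ifs <;> fun_prop
  have hexponent : (n - (i : ℕ)) = n - m + (m - i) := by omega
  rw [eq_div_iff (pow_pos ht _).ne', hΩ,
    setIntegral_eq_prod_mul_setIntegral_comp_mul (d := blockScale i t)
      (fun a => by unfold blockScale; split_ifs <;> simp [ht])
      (measurableSet_strictAnti_pos_inter i t) hp_meas]
  simp_rw [blockScale_mul_mem_iff i ht, hp, density_comp_blockScale, ofPred_mem_eq]
  rw [integral_const_mul, ← mul_assoc, prod_blockScale_pow, hexponent, mul_comm]
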